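/- Let n ≥ 1, fix i, j ∈ {1,…,n}, and let K(τ,x,y) = ∂_{y_i y_j} 𝒲_τ(x,y) for τ > 0 and K(τ,x,y) = 0 for τ ≤ 0. There exists a constant C depending only on n such that whenever τ, s ∈ ℝ and x, y, y₀ ∈ ℝⁿ satisfy 4(|s|^{1/2} + |y − y₀|) ≤ |τ − s|^{1/2} + |x − y₀|, one has |K(τ,x,y) − K(τ−s,x,y₀)| ≤ C (|s|^{1/2} + |y − y₀|) / (|τ − s|^{1/2} + |x − y₀|)^{n+3}. -/

import Mathlib

open MeasureTheory Filter Set Metric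
open scoped ENNReal NNReal Topology

noncomputable section

abbrev En (n : ℕ) := EuclideanSpace ℝ (Fin n)

/-- The hyperbolic cotangent. -/
def coth (τ : ℝ) : ℝ := Real.cosh τ / Real.sinh τ

/-- The Mehler kernel
`𝒲_τ(x,y) = (2π sinh 2τ)^{-n/2} exp(-(1/4)(|x-y|² coth τ + |x+y|² tanh τ))`,
extended by `0` for `τ ≤ 0`. -/
def Mehler (n : ℕ) (τ : ℝ) (x y : En n) : ℝ :=
  if 0 < τ then
    (2 * Real.pi * Real.sinh (2 * τ)) ^ (-(n : ℝ) / 2) *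
      Real.exp (-(1 / 4) * (‖x - y‖ ^ 2 * coth τ + ‖x + y‖ ^ 2 * Real.tanh τ))
  else 0

/-- Partial derivative of `g : ℝⁿ → ℝ` in the `i`-th coordinate direction. -/
def pd {n : ℕ} (i : Fin n) (g : En n → ℝ) (y : En n) : ℝ :=
  fderiv ℝ g y (EuclideanSpace.single i 1)

/-- Laplacian of `g : ℝⁿ → ℝ`. -/
def lap {n : ℕ} (g : En n → ℝ) (x : En n) : ℝ :=
  ∑ i : Fin n, pd i (pd i g) x

/-- `∂_{y_i y_j} 𝒲_τ(x,y)` (second partial derivative in the `y` variables). -/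
def Mij (n : ℕ) (i j : Fin n) (τ : ℝ) (x y : En n) : ℝ :=
  pd i (pd j (Mehler n τ x)) y

/-- `∂_τ 𝒲_τ(x,y)`. -/
def Mt (n : ℕ) (τ : ℝ) (x y : En n) : ℝ :=
  deriv (fun σ => Mehler n σ x y) τ

/-- The truncation region `Ω_ε(x) ∩ {τ > 0} = {(τ,y) : τ > 0, max(|τ|^{1/2}, |x-y|) > ε}`. -/
def OmegaX (n : ℕ) (ε : ℝ) (x : En n) : Set (ℝ × En n) :=
  {p | 0 < p.1 ∧ ε < max (Real.sqrt |p.1|) ‖x - p.2‖}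

/-- `A_n = (1/(n Γ(n/2))) ∫_{1/4}^∞ u^{n/2-1} e^{-u} du`. -/
def An (n : ℕ) : ℝ :=
  (1 / (n * Real.Gamma ((n : ℝ) / 2))) *
    ∫ u in Set.Ioi (1 / 4 : ℝ), u ^ ((n : ℝ) / 2 - 1) * Real.exp (-u)

/-- `B_n = (1/Γ(n/2)) ∫_0^{1/4} u^{n/2-1} e^{-u} du`. -/
def Bn (n : ℕ) : ℝ :=
  (1 / Real.Gamma ((n : ℝ) / 2)) *
    ∫ u in Set.Ioo (0 : ℝ) (1 / 4 : ℝ), u ^ ((n : ℝ) / 2 - 1) * Real.exp (-u)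

section Hyperbolic

variable {τ : ℝ}

lemma one_le_coth (h : 0 < τ) : 1 ≤ coth τ := by
  rw [coth, one_le_div (Real.sinh_pos_iff.2 h)]
  exact (Real.sinh_lt_cosh τ).le

lemma tanh_pos (h : 0 < τ) : 0 < Real.tanh τ := by
  rw [Real.tanh_eq_sinh_div_cosh]
  exact div_pos (Real.sinh_pos_iff.2 h) (Real.cosh_pos τ)

lemma coth_mul_tanh (h : 0 < τ) : coth τ * Real.tanh τ = 1 := by
  have := (Real.sinh_pos_iff.2 h).ne'
  have := (Real.cosh_pos τ).ne'
  rw [coth, Real.tanh_eq_sinh_div_cosh]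
  field_simp

lemma coth_mul_le (h : 0 < τ) : coth τ * τ ≤ 1 + τ := by
  have hs := Real.sinh_pos_iff.2 h
  have h1 : τ ≤ Real.sinh τ := Real.self_le_sinh_iff.2 h.le
  have h2 : Real.cosh τ ≤ Real.sinh τ + 1 := by
    have := Real.cosh_sub_sinh τ
    have : Real.exp (-τ) ≤ 1 := Real.exp_le_one_iff.2 (by linarith)
    linarith
  rw [coth, div_mul_eq_mul_div, div_le_iff₀ hs]
  nlinarith

lemma mul_exp_le_sinh_two_mul (h : 0 ≤ τ) : τ * Real.exp τ ≤ Real.sinh (2 * τ) := by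
  have h1 : τ ≤ Real.sinh τ := Real.self_le_sinh_iff.2 h
  have h2 : Real.exp τ ≤ 2 * Real.cosh τ := by
    rw [Real.cosh_eq]
    linarith [Real.exp_pos (-τ)]
  rw [Real.sinh_two_mul]
  calc τ * Real.exp τ ≤ Real.sinh τ * (2 * Real.cosh τ) := by gcongr
    _ = _ := by ring

lemma cosh_two_mul_div_sinh_two_mul (h : 0 < τ) :
    Real.cosh (2 * τ) / Real.sinh (2 * τ) = (coth τ + Real.tanh τ) / 2 := by
  have := (Real.sinh_pos_iff.2 h).ne'
  have := (Real.cosh_pos τ).ne'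
  rw [coth, Real.tanh_eq_sinh_div_cosh, Real.sinh_two_mul, Real.cosh_two_mul]
  field_simp

lemma hasDerivAt_coth (h : 0 < τ) : HasDerivAt coth (1 - coth τ ^ 2) τ := by
  have hs := (Real.sinh_pos_iff.2 h).ne'
  refine ((Real.hasDerivAt_cosh τ).fun_div (Real.hasDerivAt_sinh τ) hs).congr_deriv ?_
  rw [coth]
  field_simp

lemma hasDerivAt_tanh (τ : ℝ) : HasDerivAt Real.tanh (1 - Real.tanh τ ^ 2) τ := by
  have hc := (Real.cosh_pos τ).ne'
  rw [show Real.tanh = fun t => Real.sinh t / Real.cosh t from funext Real.tanh_eq_sinh_div_cosh]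
  refine ((Real.hasDerivAt_sinh τ).fun_div (Real.hasDerivAt_cosh τ) hc).congr_deriv ?_
  field_simp

lemma one_le_coth_mul (h : 0 < τ) : 1 ≤ coth τ * τ := by
  have hb := tanh_pos h
  have := (convex_univ (𝕜 := ℝ)).norm_image_sub_le_of_norm_hasDerivWithin_le (C := 1)
    (fun t _ => (hasDerivAt_tanh t).hasDerivWithinAt)
    (fun t _ => by
      rw [Real.norm_eq_abs, abs_le]
      have := Real.tanh_sq_lt_one t
      constructor <;> nlinarith [sq_nonneg (Real.tanh t)])
    (mem_univ 0) (mem_univ τ)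
  rw [Real.tanh_zero, sub_zero, sub_zero, one_mul, Real.norm_of_nonneg hb.le,
    Real.norm_of_nonneg h.le] at this
  calc 1 = coth τ * Real.tanh τ := (coth_mul_tanh h).symm
    _ ≤ coth τ * τ := by gcongr; linarith [one_le_coth h]

end Hyperbolic

lemma exists_two_add_pow_le_exp (N : ℕ) :
    ∃ C : ℝ, 0 < C ∧ ∀ t : ℝ, 0 ≤ t → (2 + t) ^ N ≤ C * Real.exp (t / 4) := by
  refine ⟨4 ^ N * N.factorial * Real.exp (1 / 2), by positivity, fun t ht => ?_⟩
  have h := Real.pow_div_factorial_le_exp ((2 + t) / 4) (by positivity) N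
  rw [div_le_iff₀ (by positivity), div_pow, div_le_iff₀ (by positivity)] at h
  refine h.trans_eq ?_
  rw [show (2 + t) / 4 = 1 / 2 + t / 4 by ring, Real.exp_add]
  ring

section Kernel

variable {n : ℕ} {τ : ℝ}

/-- The gradient in `y` of `log (Mehler n τ x y)` for `τ > 0`. -/
def mehlerGrad (τ : ℝ) (x y : En n) : En n :=
  (1 / 2 : ℝ) • (coth τ • (x - y) - Real.tanh τ • (x + y))

/-- The factor `P` for which `∂_{y_i y_j} 𝒲_τ = P 𝒲_τ` when `τ > 0`. -/
def mehlerHess (i j : Fin n) (τ : ℝ) (x y : En n) : ℝ :=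
  mehlerGrad τ x y i * mehlerGrad τ x y j -
    (if i = j then 1 else 0) * ((1 / 2) * (coth τ + Real.tanh τ))

lemma Mehler_of_pos (h : 0 < τ) (x y : En n) :
    Mehler n τ x y = (2 * Real.pi * Real.sinh (2 * τ)) ^ (-(n : ℝ) / 2) *
      Real.exp (-(1 / 4) * (‖x - y‖ ^ 2 * coth τ + ‖x + y‖ ^ 2 * Real.tanh τ)) :=
  if_pos h

lemma Mehler_nonneg (h : 0 < τ) (x y : En n) : 0 ≤ Mehler n τ x y := by
  rw [Mehler_of_pos h]
  have := Real.sinh_pos_iff.2 (show 0 < 2 * τ by positivity)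
  positivity

lemma hasFDerivAt_Mehler (h : 0 < τ) (x y : En n) :
    HasFDerivAt (Mehler n τ x) (Mehler n τ x y • innerSL ℝ (mehlerGrad τ x y)) y := by
  have h1 := ((hasFDerivAt_id y).const_sub x).norm_sq.mul_const (coth τ)
  have h2 := ((hasFDerivAt_id y).const_add x).norm_sq.mul_const (Real.tanh τ)
  have h3 := (((h1.add h2).const_mul (-(1 / 4))).exp).const_mul
    ((2 * Real.pi * Real.sinh (2 * τ)) ^ (-(n : ℝ) / 2))
  rw [show Mehler n τ x = _ from funext (Mehler_of_pos h x)]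
  refine h3.congr_fderiv ?_
  ext v
  simp [mehlerGrad]
  ring

lemma hasFDerivAt_mehlerGrad_apply (i : Fin n) (x y : En n) :
    HasFDerivAt (fun z => mehlerGrad τ x z i)
      ((-(1 / 2) * (coth τ + Real.tanh τ)) • (EuclideanSpace.proj i : En n →L[ℝ] ℝ)) y := by
  have h0 := (EuclideanSpace.proj i : En n →L[ℝ] ℝ).hasFDerivAt (x := y)
  have h1 := (((h0.const_sub (x i)).const_mul (coth τ)).sub
    ((h0.const_add (x i)).const_mul (Real.tanh τ))).const_mul (1 / 2)
  refine HasFDerivAt.congr_fderiv (f := fun z => mehlerGrad τ x z i)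
    (h1.congr_of_eventuallyEq (.of_forall fun z => ?_)) ?_
  · simp [mehlerGrad, mul_add]
  · ext v
    simp
    ring

lemma pd_Mehler (h : 0 < τ) (j : Fin n) (x y : En n) :
    pd j (Mehler n τ x) y = Mehler n τ x y * mehlerGrad τ x y j := by
  rw [pd, (hasFDerivAt_Mehler h x y).fderiv]
  simp [EuclideanSpace.inner_single_right]

lemma Mij_of_pos (h : 0 < τ) (i j : Fin n) (x y : En n) :
    Mij n i j τ x y = Mehler n τ x y * mehlerHess i j τ x y := by
  rw [Mij, pd, show pd j (Mehler n τ x) = _ from funext (pd_Mehler h j x),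
    ((hasFDerivAt_Mehler h x y).fun_mul (hasFDerivAt_mehlerGrad_apply j x y)).fderiv, mehlerHess]
  simp [EuclideanSpace.inner_single_right, eq_comm (a := i)]
  split_ifs <;> ring

lemma Mij_of_nonpos (h : τ ≤ 0) (i j : Fin n) (x y : En n) : Mij n i j τ x y = 0 := by
  have h0 : Mehler n τ x = fun _ => 0 := funext fun z => if_neg h.not_gt
  have h1 : pd j (Mehler n τ x) = fun _ => 0 := by
    funext z
    simp [pd, h0]
  simp [Mij, pd, h1]

lemma hasFDerivAt_mehlerHess (i j : Fin n) (x y : En n) :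
    HasFDerivAt (mehlerHess i j τ x)
      ((-(1 / 2) * (coth τ + Real.tanh τ)) •
        (mehlerGrad τ x y j • (EuclideanSpace.proj i : En n →L[ℝ] ℝ) +
          mehlerGrad τ x y i • (EuclideanSpace.proj j : En n →L[ℝ] ℝ))) y := by
  refine (((hasFDerivAt_mehlerGrad_apply i x y).fun_mul
    (hasFDerivAt_mehlerGrad_apply j x y)).sub_const _).congr_fderiv ?_
  ext v
  simp
  ring

/-- The derivative in `τ` of `log (Mehler n τ x y)` for `τ > 0`. -/
def mehlerLogDeriv (τ : ℝ) (x y : En n) : ℝ :=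
  -(n / 2) * (coth τ + Real.tanh τ) -
    (1 / 4) * (‖x - y‖ ^ 2 * (1 - coth τ ^ 2) + ‖x + y‖ ^ 2 * (1 - Real.tanh τ ^ 2))

/-- The derivative in `τ` of `mehlerGrad τ x y`. -/
def mehlerGradDeriv (τ : ℝ) (x y : En n) : En n :=
  (1 / 2 : ℝ) • ((1 - coth τ ^ 2) • (x - y) - (1 - Real.tanh τ ^ 2) • (x + y))

lemma hasDerivAt_Mehler (h : 0 < τ) (x y : En n) :
    HasDerivAt (fun σ => Mehler n σ x y) (Mehler n τ x y * mehlerLogDeriv τ x y) τ := by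
  have hs : 0 < Real.sinh (2 * τ) := Real.sinh_pos_iff.2 (by positivity)
  have hb : 0 < 2 * Real.pi * Real.sinh (2 * τ) := by positivity
  have h1 := ((((hasDerivAt_id τ).const_mul 2).sinh).const_mul (2 * Real.pi)).rpow_const
    (p := -(n : ℝ) / 2) (.inl hb.ne')
  have h2 := ((((hasDerivAt_coth h).const_mul (‖x - y‖ ^ 2)).add
    ((hasDerivAt_tanh τ).const_mul (‖x + y‖ ^ 2))).const_mul (-(1 / 4))).exp
  refine ((h1.mul h2).congr_of_eventuallyEq ?_).congr_deriv ?_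
  · filter_upwards [lt_mem_nhds h] with σ hσ
    simp [Mehler_of_pos hσ]
  · have hc := cosh_two_mul_div_sinh_two_mul h
    rw [div_eq_iff hs.ne'] at hc
    simp only [id, Pi.add_apply, Real.rpow_sub_one hb.ne', Mehler_of_pos h, mehlerLogDeriv, hc]
    field_simp
    ring

lemma hasDerivAt_mehlerGrad_apply (h : 0 < τ) (i : Fin n) (x y : En n) :
    HasDerivAt (fun σ => mehlerGrad σ x y i) (mehlerGradDeriv τ x y i) τ := by
  have h1 := (((hasDerivAt_coth h).mul_const (x i - y i)).sub
    ((hasDerivAt_tanh τ).mul_const (x i + y i))).const_mul (1 / 2)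
  refine (h1.congr_of_eventuallyEq (.of_forall fun σ => ?_)).congr_deriv ?_
  · simp [mehlerGrad, mul_add]
  · simp [mehlerGradDeriv, mul_add]

lemma hasDerivAt_mehlerHess (h : 0 < τ) (i j : Fin n) (x y : En n) :
    HasDerivAt (fun σ => mehlerHess i j σ x y)
      (mehlerGradDeriv τ x y i * mehlerGrad τ x y j +
        mehlerGrad τ x y i * mehlerGradDeriv τ x y j -
        (if i = j then 1 else 0) * ((1 / 2) * (1 - coth τ ^ 2 + (1 - Real.tanh τ ^ 2)))) τ :=
  ((hasDerivAt_mehlerGrad_apply h i x y).fun_mul (hasDerivAt_mehlerGrad_apply h j x y)).fun_sub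
    ((((hasDerivAt_coth h).fun_add (hasDerivAt_tanh τ)).const_mul (1 / 2)).const_mul _)

end Kernel

section Estimates

variable {n : ℕ} {τ : ℝ}

/-- The size of `mehlerGrad τ x y`, which measures the growth of derivatives of the Mehler kernel:
a derivative of parabolic order `k` is dominated by `Mehler n τ x y * mehlerGrowth τ x y ^ k`. -/
def mehlerGrowth (τ : ℝ) (x y : En n) : ℝ :=
  √(coth τ) + coth τ * ‖x - y‖ + ‖x + y‖

lemma coth_le_mehlerGrowth_sq (h : 0 < τ) (x y : En n) : coth τ ≤ mehlerGrowth τ x y ^ 2 := by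
  have ha := one_le_coth h
  calc coth τ = √(coth τ) ^ 2 := (Real.sq_sqrt (by linarith)).symm
    _ ≤ _ := by
      unfold mehlerGrowth
      gcongr
      rw [add_assoc]
      exact le_add_of_nonneg_right (by positivity)

lemma one_le_mehlerGrowth (h : 0 < τ) (x y : En n) : 1 ≤ mehlerGrowth τ x y := by
  have ha := one_le_coth h
  have : 0 ≤ coth τ := by linarith
  have := Real.one_le_sqrt.2 ha
  unfold mehlerGrowth
  have : 0 ≤ coth τ * ‖x - y‖ := by positivity
  linarith [norm_nonneg (x + y)]

lemma coth_mul_norm_le_mehlerGrowth (τ : ℝ) (x y : En n) :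
    coth τ * ‖x - y‖ + ‖x + y‖ ≤ mehlerGrowth τ x y := by
  unfold mehlerGrowth
  linarith [Real.sqrt_nonneg (coth τ)]

lemma norm_mehlerGrad_le (h : 0 < τ) (x y : En n) :
    ‖mehlerGrad τ x y‖ ≤ mehlerGrowth τ x y := by
  have ha : 0 ≤ coth τ := by linarith [one_le_coth h]
  have hb := tanh_pos h
  have hb1 := (Real.tanh_lt_one τ).le
  have hE := coth_mul_norm_le_mehlerGrowth τ x y
  have h1 : ‖coth τ • (x - y) - Real.tanh τ • (x + y)‖ ≤ mehlerGrowth τ x y := by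
    refine (norm_sub_le _ _).trans (le_trans ?_ hE)
    rw [norm_smul, norm_smul, Real.norm_of_nonneg ha, Real.norm_of_nonneg hb.le]
    gcongr
    exact mul_le_of_le_one_left (norm_nonneg _) hb1
  rw [mehlerGrad, norm_smul, Real.norm_of_nonneg (by norm_num)]
  linarith [norm_nonneg (coth τ • (x - y) - Real.tanh τ • (x + y))]

lemma abs_mehlerGrad_apply_le (h : 0 < τ) (i : Fin n) (x y : En n) :
    |mehlerGrad τ x y i| ≤ mehlerGrowth τ x y :=
  (PiLp.norm_apply_le _ i).trans (norm_mehlerGrad_le h x y)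

lemma norm_mehlerGradDeriv_le (h : 0 < τ) (x y : En n) :
    ‖mehlerGradDeriv τ x y‖ ≤ mehlerGrowth τ x y ^ 3 := by
  have ha := one_le_coth h
  have ha0 : 0 ≤ coth τ := by linarith
  have hE := coth_mul_norm_le_mehlerGrowth τ x y
  have hE1 := one_le_mehlerGrowth h x y
  have hE2 := coth_le_mehlerGrowth_sq h x y
  have hb := Real.tanh_sq_lt_one τ
  have h1 : ‖(1 - coth τ ^ 2) • (x - y) - (1 - Real.tanh τ ^ 2) • (x + y)‖ ≤
      mehlerGrowth τ x y ^ 3 := by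
    refine (norm_sub_le _ _).trans ?_
    rw [norm_smul, norm_smul, Real.norm_of_nonpos (by nlinarith), Real.norm_of_nonneg (by linarith)]
    calc -(1 - coth τ ^ 2) * ‖x - y‖ + (1 - Real.tanh τ ^ 2) * ‖x + y‖
        ≤ coth τ ^ 2 * ‖x - y‖ + coth τ * ‖x + y‖ := by
          gcongr
          · linarith
          · nlinarith [sq_nonneg (Real.tanh τ)]
      _ = coth τ * (coth τ * ‖x - y‖ + ‖x + y‖) := by ring
      _ ≤ mehlerGrowth τ x y ^ 2 * mehlerGrowth τ x y := by gcongr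
      _ = _ := by ring
  rw [mehlerGradDeriv, norm_smul, Real.norm_of_nonneg (by norm_num)]
  linarith [norm_nonneg ((1 - coth τ ^ 2) • (x - y) - (1 - Real.tanh τ ^ 2) • (x + y))]

lemma abs_mehlerGradDeriv_apply_le (h : 0 < τ) (i : Fin n) (x y : En n) :
    |mehlerGradDeriv τ x y i| ≤ mehlerGrowth τ x y ^ 3 :=
  (PiLp.norm_apply_le _ i).trans (norm_mehlerGradDeriv_le h x y)

lemma coth_add_tanh_le (h : 0 < τ) (x y : En n) :
    coth τ + Real.tanh τ ≤ 2 * mehlerGrowth τ x y ^ 2 := by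
  linarith [coth_le_mehlerGrowth_sq h x y, one_le_coth h, Real.tanh_lt_one τ]

lemma abs_mehlerHess_le (h : 0 < τ) (i j : Fin n) (x y : En n) :
    |mehlerHess i j τ x y| ≤ 2 * mehlerGrowth τ x y ^ 2 := by
  have hE1 := one_le_mehlerGrowth h x y
  have h1 : |mehlerGrad τ x y i * mehlerGrad τ x y j| ≤
      mehlerGrowth τ x y * mehlerGrowth τ x y := by
    rw [abs_mul]
    gcongr <;> exact abs_mehlerGrad_apply_le h _ x y
  have h2 := coth_add_tanh_le h x y
  have h3 : 0 ≤ coth τ + Real.tanh τ := by linarith [one_le_coth h, tanh_pos h]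
  rw [abs_le] at h1 ⊢
  unfold mehlerHess
  split_ifs <;> constructor <;> nlinarith

lemma abs_mehlerLogDeriv_le (h : 0 < τ) (x y : En n) :
    |mehlerLogDeriv τ x y| ≤ (n + 1) * mehlerGrowth τ x y ^ 2 := by
  have ha := one_le_coth h
  have hb := Real.tanh_sq_lt_one τ
  have h0 := tanh_pos h
  have hE := coth_mul_norm_le_mehlerGrowth τ x y
  have h1 : (n : ℝ) / 2 * (coth τ + Real.tanh τ) ≤ n * mehlerGrowth τ x y ^ 2 := by
    calc _ ≤ (n : ℝ) / 2 * (2 * mehlerGrowth τ x y ^ 2) := by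
          gcongr
          exact coth_add_tanh_le h x y
      _ = _ := by ring
  have h1' : 0 ≤ (n : ℝ) / 2 * (coth τ + Real.tanh τ) := by positivity
  have h2 : (coth τ * ‖x - y‖) ^ 2 ≤ mehlerGrowth τ x y ^ 2 := by
    gcongr
    linarith [norm_nonneg (x + y)]
  have h3 : ‖x + y‖ ^ 2 ≤ mehlerGrowth τ x y ^ 2 := by
    gcongr
    linarith [mul_nonneg (zero_le_one.trans ha) (norm_nonneg (x - y))]
  have h4 : ‖x - y‖ ^ 2 ≤ (coth τ * ‖x - y‖) ^ 2 := by
    gcongr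
    exact le_mul_of_one_le_left (norm_nonneg _) ha
  have h5 : ‖x + y‖ ^ 2 * Real.tanh τ ^ 2 ≤ ‖x + y‖ ^ 2 :=
    mul_le_of_le_one_right (by positivity) hb.le
  have h6 : 0 ≤ ‖x + y‖ ^ 2 * Real.tanh τ ^ 2 := by positivity
  have h7 : 0 ≤ ‖x - y‖ ^ 2 := by positivity
  rw [abs_le]
  unfold mehlerLogDeriv
  constructor <;> nlinarith

/-- A derivative of parabolic order `k` of the Mehler kernel, multiplied by
the power `n + k + 2 * l` of the parabolic distance, is at most a multiple of `τ ^ l`. -/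
lemma exists_Mehler_mul_growth_le (hn : 1 ≤ n) (k l : ℕ) :
    ∃ C : ℝ, 0 < C ∧ ∀ (τ : ℝ) (x y : En n), 0 < τ →
      Mehler n τ x y * mehlerGrowth τ x y ^ k * (√τ + ‖x - y‖) ^ (n + k + 2 * l) ≤
        C * τ ^ l := by
  obtain ⟨C₁, hC₁, h₁⟩ := exists_two_add_pow_le_exp k
  obtain ⟨C₂, hC₂, h₂⟩ := exists_two_add_pow_le_exp (k + (n + k + 2 * l))
  refine ⟨C₁ * C₂, by positivity, fun τ x y h => ?_⟩
  have ha := one_le_coth h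
  have ha0 : 0 < coth τ := by linarith
  have hab := coth_mul_tanh h
  have hb := tanh_pos h
  set α := √(coth τ) with hα
  have hα2 : α ^ 2 = coth τ := Real.sq_sqrt ha0.le
  have hα1 : 1 ≤ α := Real.one_le_sqrt.2 ha
  have hα0 : 0 < α := by linarith
  have hτ : √τ ^ 2 = τ := Real.sq_sqrt h.le
  set p := α * ‖x - y‖ with hp
  set q := ‖x + y‖ / α with hq
  have hp0 : 0 ≤ p := by positivity
  have hq0 : 0 ≤ q := by positivity
  have hE : mehlerGrowth τ x y = α * (1 + p + q) := by
    rw [mehlerGrowth, ← hα, ← hα2, hp, hq]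
    field_simp
  have hexp : ‖x - y‖ ^ 2 * coth τ + ‖x + y‖ ^ 2 * Real.tanh τ = p ^ 2 + q ^ 2 := by
    rw [eq_div_of_mul_eq ha0.ne' ((mul_comm _ _).trans hab), hp, hq, ← hα2]
    field_simp
  have hατ : 1 ≤ α * √τ := by
    refine (one_le_sq_iff₀ (by positivity)).1 ?_
    rw [mul_pow, hα2, hτ]
    exact one_le_coth_mul h
  have hατ' : α * √τ ≤ 2 + 2 * τ := by
    refine (sq_le_sq₀ (by positivity) (by positivity)).1 ?_
    rw [mul_pow, hα2, hτ]
    nlinarith [coth_mul_le h]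
  have hρ : √τ + ‖x - y‖ ≤ √τ * (1 + p + q) := by
    have : ‖x - y‖ ≤ √τ * p := by
      rw [hp, ← mul_assoc, mul_comm √τ]
      exact le_mul_of_one_le_left (norm_nonneg _) hατ
    nlinarith [Real.sqrt_nonneg τ]
  have hT : 1 + p + q ≤ 2 + (p ^ 2 + q ^ 2) := by nlinarith [sq_nonneg (p - 1), sq_nonneg (q - 1)]
  have hW : √τ ^ n * (2 * Real.pi * Real.sinh (2 * τ)) ^ (-(n : ℝ) / 2) ≤
      (Real.exp (2 * τ / 4))⁻¹ := by
    have h1 : τ * Real.exp τ ≤ 2 * Real.pi * Real.sinh (2 * τ) := by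
      have h3 := mul_exp_le_sinh_two_mul h.le
      have h4 : 0 < τ * Real.exp τ := by positivity
      nlinarith [Real.pi_gt_three]
    have h2 : (τ * Real.exp τ) ^ (-(n : ℝ) / 2) = (√τ ^ n * Real.exp (τ / 2) ^ n)⁻¹ := by
      rw [neg_div, Real.rpow_neg (by positivity), Real.rpow_div_two_eq_sqrt _ (by positivity),
        Real.rpow_natCast, Real.sqrt_mul h.le, ← Real.exp_half, mul_pow]
    calc _ ≤ √τ ^ n * (τ * Real.exp τ) ^ (-(n : ℝ) / 2) := by
          gcongr ?_ * ?_
          exact Real.rpow_le_rpow_of_nonpos (by positivity) h1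
            (by rw [neg_div]; exact neg_nonpos.2 (by positivity))
      _ = (Real.exp (τ / 2) ^ n)⁻¹ := by
          rw [h2]
          field_simp
      _ ≤ _ := by
          rw [show 2 * τ / 4 = τ / 2 by ring]
          gcongr
          exact le_self_pow₀ (Real.one_le_exp (by positivity)) (by omega)
  rw [Mehler_of_pos h, hexp, hE]
  calc _ ≤ (2 * Real.pi * Real.sinh (2 * τ)) ^ (-(n : ℝ) / 2) *
        Real.exp (-(1 / 4) * (p ^ 2 + q ^ 2)) * (α * (1 + p + q)) ^ k *
          (√τ * (1 + p + q)) ^ (n + k + 2 * l) := by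
        have := Real.sinh_pos_iff.2 (show 0 < 2 * τ by positivity)
        gcongr
    _ = (α * √τ) ^ k *
        (√τ ^ n * (2 * Real.pi * Real.sinh (2 * τ)) ^ (-(n : ℝ) / 2)) *
        ((1 + p + q) ^ (k + (n + k + 2 * l)) * (Real.exp ((p ^ 2 + q ^ 2) / 4))⁻¹) * (√τ ^ 2) ^ l := by
        rw [← Real.exp_neg, show -((p ^ 2 + q ^ 2) / 4) = -(1 / 4) * (p ^ 2 + q ^ 2) by ring]
        generalize 1 + p + q = T
        ring
    _ ≤ (C₁ * Real.exp (2 * τ / 4)) * (Real.exp (2 * τ / 4))⁻¹ *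
        ((C₂ * Real.exp ((p ^ 2 + q ^ 2) / 4)) * (Real.exp ((p ^ 2 + q ^ 2) / 4))⁻¹) *
          (√τ ^ 2) ^ l := by
        gcongr
        · exact (pow_le_pow_left₀ (by positivity) hατ' k).trans (h₁ _ (by positivity))
        · exact (pow_le_pow_left₀ (by positivity) hT _).trans (h₂ _ (by positivity))
    _ = C₁ * C₂ * τ ^ l := by
        rw [hτ]
        field_simp

lemma norm_fderiv_Mij_le (h : 0 < τ) (i j : Fin n) (x y : En n) :
    DifferentiableAt ℝ (Mij n i j τ x) y ∧
      ‖fderiv ℝ (Mij n i j τ x) y‖ ≤ 4 * (Mehler n τ x y * mehlerGrowth τ x y ^ 3) := by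
  have hM := Mehler_nonneg h x y
  have hE1 := one_le_mehlerGrowth h x y
  have hd := (hasFDerivAt_Mehler h x y).fun_mul (hasFDerivAt_mehlerHess i j x y (τ := τ))
  rw [show Mij n i j τ x = _ from funext (Mij_of_pos h i j x)]
  refine ⟨hd.differentiableAt, ?_⟩
  rw [hd.fderiv]
  refine ContinuousLinearMap.opNorm_le_bound _ (by positivity) fun v => ?_
  have hab : 0 ≤ coth τ + Real.tanh τ := by linarith [one_le_coth h, tanh_pos h]
  have hab' := coth_add_tanh_le h x y
  have h1 : |mehlerGrad τ x y j * v i + mehlerGrad τ x y i * v j| ≤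
      2 * mehlerGrowth τ x y * ‖v‖ := by
    calc _ ≤ |mehlerGrad τ x y j| * ‖v i‖ + |mehlerGrad τ x y i| * ‖v j‖ := by
          refine (abs_add_le _ _).trans_eq ?_
          simp [abs_mul]
      _ ≤ mehlerGrowth τ x y * ‖v‖ + mehlerGrowth τ x y * ‖v‖ := by
          gcongr
          · exact abs_mehlerGrad_apply_le h j x y
          · exact PiLp.norm_apply_le v i
          · exact abs_mehlerGrad_apply_le h i x y
          · exact PiLp.norm_apply_le v j
      _ = _ := by ring
  have h2 : |(-(1 / 2) * (coth τ + Real.tanh τ)) *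
      (mehlerGrad τ x y j * v i + mehlerGrad τ x y i * v j)| ≤
      2 * mehlerGrowth τ x y ^ 3 * ‖v‖ := by
    rw [abs_mul, abs_mul, abs_of_nonneg hab]
    calc _ ≤ |(-(1 / 2) : ℝ)| * (2 * mehlerGrowth τ x y ^ 2) *
          (2 * mehlerGrowth τ x y * ‖v‖) := by gcongr
      _ = _ := by
        rw [abs_of_neg (by norm_num)]
        ring
  have h3 : |mehlerHess i j τ x y * inner ℝ (mehlerGrad τ x y) v| ≤
      2 * mehlerGrowth τ x y ^ 3 * ‖v‖ := by
    rw [abs_mul]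
    calc _ ≤ 2 * mehlerGrowth τ x y ^ 2 * (mehlerGrowth τ x y * ‖v‖) := by
          gcongr
          · exact abs_mehlerHess_le h i j x y
          · refine (abs_real_inner_le_norm _ _).trans ?_
            gcongr
            exact norm_mehlerGrad_le h x y
      _ = _ := by ring
  calc _ = |Mehler n τ x y * ((-(1 / 2) * (coth τ + Real.tanh τ)) *
        (mehlerGrad τ x y j * v i + mehlerGrad τ x y i * v j) +
          mehlerHess i j τ x y * inner ℝ (mehlerGrad τ x y) v)| := by
        rw [Real.norm_eq_abs]
        congr 1
        simp
        ring
    _ ≤ Mehler n τ x y * (2 * mehlerGrowth τ x y ^ 3 * ‖v‖ +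
          2 * mehlerGrowth τ x y ^ 3 * ‖v‖) := by
        rw [abs_mul, abs_of_nonneg hM]
        gcongr
        exact (abs_add_le _ _).trans (add_le_add h2 h3)
    _ = _ := by ring

lemma abs_deriv_Mij_le (h : 0 < τ) (i j : Fin n) (x y : En n) :
    DifferentiableAt ℝ (fun σ => Mij n i j σ x y) τ ∧
      |deriv (fun σ => Mij n i j σ x y) τ| ≤
        (2 * n + 5) * (Mehler n τ x y * mehlerGrowth τ x y ^ 4) := by
  have hM := Mehler_nonneg h x y
  have hE1 := one_le_mehlerGrowth h x y
  have hd := ((hasDerivAt_Mehler h x y).fun_mul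
    (hasDerivAt_mehlerHess h i j x y)).congr_of_eventuallyEq
      (f₁ := fun σ => Mij n i j σ x y) (by
        filter_upwards [lt_mem_nhds h] with σ hσ using Mij_of_pos hσ i j x y)
  refine ⟨hd.differentiableAt, ?_⟩
  rw [hd.deriv]
  set E := mehlerGrowth τ x y
  have h1 : |mehlerLogDeriv τ x y * mehlerHess i j τ x y| ≤ (2 * n + 2) * E ^ 4 := by
    rw [abs_mul]
    calc _ ≤ ((n + 1) * E ^ 2) * (2 * E ^ 2) := by
          gcongr
          · exact abs_mehlerLogDeriv_le h x y
          · exact abs_mehlerHess_le h i j x y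
      _ = _ := by ring
  have h2 : ∀ k l : Fin n, |mehlerGradDeriv τ x y k * mehlerGrad τ x y l| ≤ E ^ 4 := by
    intro k l
    rw [abs_mul]
    calc _ ≤ E ^ 3 * E := by
          gcongr
          · exact abs_mehlerGradDeriv_apply_le h k x y
          · exact abs_mehlerGrad_apply_le h l x y
      _ = _ := by ring
  have h3 : |(if i = j then 1 else 0) *
      ((1 / 2) * (1 - coth τ ^ 2 + (1 - Real.tanh τ ^ 2)))| ≤ E ^ 4 := by
    have hc : coth τ ^ 2 ≤ E ^ 4 := by
      calc coth τ ^ 2 ≤ (E ^ 2) ^ 2 := by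
            have := one_le_coth h
            gcongr
            exact coth_le_mehlerGrowth_sq h x y
        _ = _ := by ring
    have ha : 1 ≤ coth τ ^ 2 := one_le_pow₀ (one_le_coth h)
    have hb := Real.tanh_sq_lt_one τ
    have hb0 := sq_nonneg (Real.tanh τ)
    split_ifs
    · rw [one_mul, abs_le]
      constructor <;> linarith
    · rw [zero_mul, abs_zero]
      positivity
  have h4 := h2 i j
  have h5 := h2 j i
  rw [abs_le] at h1 h3 h4 h5
  calc _ = |Mehler n τ x y * (mehlerLogDeriv τ x y * mehlerHess i j τ x y +
        (mehlerGradDeriv τ x y i * mehlerGrad τ x y j +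
        mehlerGrad τ x y i * mehlerGradDeriv τ x y j -
        (if i = j then 1 else 0) *
          ((1 / 2) * (1 - coth τ ^ 2 + (1 - Real.tanh τ ^ 2)))))| := by
        congr 1
        ring
    _ ≤ Mehler n τ x y * ((2 * n + 5) * E ^ 4) := by
        rw [abs_mul, abs_of_nonneg hM]
        gcongr
        rw [abs_le]
        constructor <;> linarith
    _ = _ := by ring

lemma exists_abs_Mij_sub_le_space (hn : 1 ≤ n) (i j : Fin n) :
    ∃ C : ℝ, 0 < C ∧ ∀ (τ M : ℝ) (x y y₀ : En n), 0 < M →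
      (∀ z ∈ segment ℝ y₀ y, M ≤ √|τ| + ‖x - z‖) →
      |Mij n i j τ x y - Mij n i j τ x y₀| ≤ C * ‖y - y₀‖ / M ^ (n + 3) := by
  obtain ⟨C, hC, hG⟩ := exists_Mehler_mul_growth_le hn 3 0
  refine ⟨4 * C, by positivity, fun τ M x y y₀ hM hseg => ?_⟩
  rcases le_or_gt τ 0 with h | h
  · simp only [Mij_of_nonpos h, sub_zero, abs_zero]
    positivity
  rw [abs_of_pos h] at hseg
  rw [mul_div_right_comm]
  refine (convex_segment y₀ y).norm_image_sub_le_of_norm_fderiv_le (𝕜 := ℝ)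
    (fun z _ => (norm_fderiv_Mij_le h i j x z).1) (fun z hz => ?_)
    (left_mem_segment ℝ y₀ y) (right_mem_segment ℝ y₀ y)
  refine (norm_fderiv_Mij_le h i j x z).2.trans ?_
  rw [mul_div_assoc]
  gcongr
  rw [le_div_iff₀ (by positivity)]
  have := one_le_mehlerGrowth h x z
  have := Mehler_nonneg h x z
  refine le_trans ?_ ((hG τ x z h).trans_eq (by simp))
  gcongr
  exact hseg z hz

lemma exists_abs_Mij_le (hn : 1 ≤ n) (i j : Fin n) :
    ∃ C : ℝ, 0 < C ∧ ∀ (τ M : ℝ) (x y : En n), 0 < M → 0 < τ → M ≤ √τ + ‖x - y‖ →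
      |Mij n i j τ x y| ≤ C * τ / M ^ (n + 4) := by
  obtain ⟨C, hC, hG⟩ := exists_Mehler_mul_growth_le hn 2 1
  refine ⟨2 * C, by positivity, fun τ M x y hM h hle => ?_⟩
  have := one_le_mehlerGrowth h x y
  have hM0 := Mehler_nonneg h x y
  rw [Mij_of_pos h, abs_mul, abs_of_nonneg hM0, le_div_iff₀ (by positivity)]
  calc _ ≤ Mehler n τ x y * (2 * mehlerGrowth τ x y ^ 2) * (√τ + ‖x - y‖) ^ (n + 4) := by
        gcongr
        exact abs_mehlerHess_le h i j x y
    _ = 2 * (Mehler n τ x y * mehlerGrowth τ x y ^ 2 * (√τ + ‖x - y‖) ^ (n + 2 + 2 * 1)) := by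
        ring
    _ ≤ 2 * (C * τ ^ 1) := mul_le_mul_of_nonneg_left (hG τ x y h) zero_le_two
    _ = _ := by ring

lemma exists_abs_Mij_sub_le_time (hn : 1 ≤ n) (i j : Fin n) :
    ∃ C : ℝ, 0 < C ∧ ∀ (τ₀ τ M : ℝ) (x y : En n), 0 < M →
      (∀ σ ∈ uIcc τ₀ τ, M ≤ √|σ| + ‖x - y‖) →
      |Mij n i j τ x y - Mij n i j τ₀ x y| ≤ C * |τ - τ₀| / M ^ (n + 4) := by
  obtain ⟨C₁, hC₁, hG⟩ := exists_Mehler_mul_growth_le hn 4 0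
  obtain ⟨C₂, hC₂, hK⟩ := exists_abs_Mij_le hn i j
  refine ⟨(2 * n + 5) * C₁ + C₂, by positivity, fun τ₀ τ M x y hM hseg => ?_⟩
  have hK' : ∀ σ ∈ uIcc τ₀ τ, 0 < σ → σ ≤ |τ - τ₀| →
      |Mij n i j σ x y| ≤ ((2 * n + 5) * C₁ + C₂) * |τ - τ₀| / M ^ (n + 4) := by
    intro σ hσ h hle
    have h1 := hseg σ hσ
    rw [abs_of_pos h] at h1
    refine (hK σ M x y hM h h1).trans ?_
    gcongr
    exact le_add_of_nonneg_left (by positivity)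
  rcases le_or_gt τ 0 with h | h <;> rcases le_or_gt τ₀ 0 with h₀ | h₀
  · simp only [Mij_of_nonpos h, Mij_of_nonpos h₀, sub_zero, abs_zero]
    positivity
  · rw [Mij_of_nonpos h, zero_sub, abs_neg]
    exact hK' τ₀ left_mem_uIcc h₀ (by
      rw [abs_sub_comm]
      exact le_trans (by linarith) (le_abs_self _))
  · rw [Mij_of_nonpos h₀, sub_zero]
    exact hK' τ right_mem_uIcc h (le_trans (by linarith) (le_abs_self _))
  have hpos : ∀ σ ∈ uIcc τ₀ τ, 0 < σ := fun σ hσ => (lt_min h₀ h).trans_le hσ.1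
  rw [mul_div_right_comm]
  refine (convex_uIcc τ₀ τ).norm_image_sub_le_of_norm_deriv_le
    (f := fun σ => Mij n i j σ x y)
    (fun σ hσ => (abs_deriv_Mij_le (hpos σ hσ) i j x y).1) (fun σ hσ => ?_)
    left_mem_uIcc right_mem_uIcc
  have hσ0 := hpos σ hσ
  refine (abs_deriv_Mij_le hσ0 i j x y).2.trans ?_
  rw [le_div_iff₀ (by positivity)]
  have := one_le_mehlerGrowth hσ0 x y
  have := Mehler_nonneg hσ0 x y
  have h1 := hseg σ hσ
  rw [abs_of_pos hσ0] at h1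
  calc _ ≤ (2 * n + 5) * (Mehler n σ x y * mehlerGrowth σ x y ^ 4) *
        (√σ + ‖x - y‖) ^ (n + 4) := by gcongr
    _ = (2 * n + 5) * (Mehler n σ x y * mehlerGrowth σ x y ^ 4 *
        (√σ + ‖x - y‖) ^ (n + 4 + 2 * 0)) := by ring
    _ ≤ (2 * n + 5) * (C₁ * σ ^ 0) :=
        mul_le_mul_of_nonneg_left (hG σ x y hσ0) (by positivity)
    _ ≤ _ := by
        rw [pow_zero, mul_one]
        exact le_add_of_nonneg_right hC₂.le

end Estimates

lemma sqrt_abs_sub_sqrt_abs_le {σ τ s : ℝ} (h : σ ∈ uIcc (τ - s) τ) :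
    √|τ - s| - √|s| ≤ √|σ| := by
  have h1 : |τ - s| ≤ |σ| + |s| := by
    have h2 : |σ - (τ - s)| ≤ |s| := by
      have := abs_sub_left_of_mem_uIcc h
      rwa [sub_sub_cancel] at this
    have := abs_sub_abs_le_abs_sub (τ - s) σ
    rw [abs_sub_comm (τ - s)] at this
    linarith
  rw [sub_le_iff_le_add, Real.sqrt_le_iff]
  refine ⟨by positivity, ?_⟩
  nlinarith [Real.sq_sqrt (abs_nonneg σ), Real.sq_sqrt (abs_nonneg s),
    mul_nonneg (Real.sqrt_nonneg |σ|) (Real.sqrt_nonneg |s|)]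

/-- parabolic smoothness (Hölder) estimate for the kernel
`K(τ,x,y) = ∂_{y_iy_j}𝒲_τ(x,y)` (extended by `0` for `τ ≤ 0`, as built into `Mehler`):
whenever `4(|s|^{1/2} + |y-y₀|) ≤ |τ-s|^{1/2} + |x-y₀|`,
`|K(τ,x,y) − K(τ-s,x,y₀)| ≤ C (|s|^{1/2} + |y-y₀|)/(|τ-s|^{1/2} + |x-y₀|)^{n+3}`,
with `C = C(n)`. -/
theorem mehler_kernel_smoothness_estimate (n : ℕ) (hn : 1 ≤ n) (i j : Fin n) :
    ∃ C : ℝ, 0 < C ∧ ∀ (τ s : ℝ) (x y y₀ : En n),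
      4 * (Real.sqrt |s| + ‖y - y₀‖) ≤ Real.sqrt |τ - s| + ‖x - y₀‖ →
      |Mij n i j τ x y - Mij n i j (τ - s) x y₀| ≤
        C * (Real.sqrt |s| + ‖y - y₀‖) /
          (Real.sqrt |τ - s| + ‖x - y₀‖) ^ ((n : ℝ) + 3) := by
  obtain ⟨C₁, hC₁, ht⟩ := exists_abs_Mij_sub_le_time hn i j
  obtain ⟨C₂, hC₂, hy⟩ := exists_abs_Mij_sub_le_space hn i j
  refine ⟨2 ^ (n + 4) * (C₁ + C₂), by positivity, fun τ s x y y₀ h => ?_⟩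
  set d := √|s| + ‖y - y₀‖ with hd
  set R := √|τ - s| + ‖x - y₀‖ with hR
  have hs0 := Real.sqrt_nonneg |s|
  have hy0 := norm_nonneg (y - y₀)
  have hd0 : 0 ≤ d := by positivity
  have hR0 : 0 ≤ R := by positivity
  rcases hR0.eq_or_lt with hR1 | hR1
  · have h1 : √|s| = 0 := by linarith
    have h2 : ‖y - y₀‖ = 0 := by linarith
    rw [Real.sqrt_eq_zero (abs_nonneg s), abs_eq_zero] at h1
    rw [norm_eq_zero, sub_eq_zero] at h2
    rw [h1, h2, sub_zero, sub_self, abs_zero]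
    positivity
  have h1 := ht (τ - s) τ (R / 2) x y (by positivity) (fun σ hσ => by
    have := sqrt_abs_sub_sqrt_abs_le hσ
    have := norm_sub_le_norm_sub_add_norm_sub x y y₀
    linarith)
  have h2 := hy (τ - s) (R / 2) x y y₀ (by positivity) (fun z hz => by
    have h3 : ‖z - y₀‖ ≤ ‖y - y₀‖ := by
      have := norm_sub_le_of_mem_segment hz
      simpa [norm_sub_rev] using this
    have := norm_sub_le_norm_sub_add_norm_sub x z y₀
    linarith)
  rw [sub_sub_cancel] at h1
  have hs : |s| ≤ d * R := by
    calc |s| = √|s| * √|s| := (Real.mul_self_sqrt (abs_nonneg s)).symm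
      _ ≤ d * R := by gcongr <;> linarith
  rw [show (n : ℝ) + 3 = ((n + 3 : ℕ) : ℝ) by push_cast; rfl, Real.rpow_natCast]
  calc _ ≤ C₁ * |s| / (R / 2) ^ (n + 4) + C₂ * ‖y - y₀‖ / (R / 2) ^ (n + 3) :=
        (abs_sub_le _ _ _).trans (add_le_add h1 h2)
    _ ≤ C₁ * (d * R) / (R / 2) ^ (n + 4) + 2 * (C₂ * d / (R / 2) ^ (n + 3)) := by
        refine add_le_add (by gcongr) ?_
        calc _ ≤ C₂ * d / (R / 2) ^ (n + 3) := by
              gcongr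
              linarith
          _ ≤ _ := by
              have : 0 ≤ C₂ * d / (R / 2) ^ (n + 3) := by positivity
              linarith
    _ = _ := by
        simp only [div_pow, pow_succ]
        field_simp
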